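/- (Gaussian complexity of feed-forward networks) Let F be the class of depth-ι feed-forward networks f(x) = l^{(ι)}∘⋯∘l^{(1)}(x) with l^{(k)}(x) = φ(W^{(k)} x) for k < ι (λ-Lipschitz activation φ applied coordinatewise, φ(0)=0) and l^{(ι)}(x) = W^{(ι)} x, where each ‖W^{(k)}‖_{1,∞} ≤ ω. Then for data matrix X ∈ ℝ^{n×d₀}, the Gaussian complexity satisfies G(F(X)) ≤ (2ω)^ι λ^{ι−1} √(2 log(2 d₀)) · max_k √(Σ_{i=1}^n X_{i,k}²). -/

import Mathlib

open MeasureTheory ProbabilityTheory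

/-- Hidden layers of a feed-forward network: `nnHidden 0 = x`, and
`nnHidden (k+1) = φ ∘ (W k ·)` coordinatewise. -/
def nnHidden (φ : ℝ → ℝ) (d : ℕ → ℕ)
    (W : ∀ k : ℕ, Matrix (Fin (d (k + 1))) (Fin (d k)) ℝ)
    (x : Fin (d 0) → ℝ) : (k : ℕ) → Fin (d k) → ℝ
  | 0 => x
  | k + 1 => fun i => φ ((W k).mulVec (nnHidden φ d W x k) i)

/-- The `‖·‖_{1,∞}` norm of a matrix: `max_i Σ_j |W i j|`. -/
noncomputable def norm1inf {a b : ℕ} (W : Matrix (Fin a) (Fin b) ℝ) : ℝ :=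
  ⨆ i, ∑ j, |W i j|

/-- The class of depth-`ι = m+1` feed-forward networks with architecture `d` (`d (m+1) = 1`),
`λ`-Lipschitz activation `φ` on the nnHidden layers, a linear last layer, and all interaction
matrices bounded by `ω` in `‖·‖_{1,∞}`. The scalar output is the (unique, since
`d (m+1) = 1`) coordinate of the last layer, written as a sum. -/
def nnClass (φ : ℝ → ℝ) (d : ℕ → ℕ) (m : ℕ) (ω : ℝ) :
    Set ((Fin (d 0) → ℝ) → ℝ) :=
  {g | ∃ W : ∀ k : ℕ, Matrix (Fin (d (k + 1))) (Fin (d k)) ℝ,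
    (∀ k, k ≤ m → norm1inf (W k) ≤ ω) ∧
    g = fun x => ∑ i, (W m).mulVec (nnHidden φ d W x m) i}

noncomputable def gmu (n : ℕ) : Measure (Fin n → ℝ) :=
  Measure.pi fun _ : Fin n => gaussianReal 0 1

instance gmu_prob (n : ℕ) : IsProbabilityMeasure (gmu n) := by
  unfold gmu; infer_instance

noncomputable def supH {n : ℕ} {A : Type*} (f : A → Fin n → ℝ) (ξ : Fin n → ℝ) : ℝ :=
  ⨆ a, ∑ i, ξ i * f a i

def Bdd {n : ℕ} {A : Type*} (f : A → Fin n → ℝ) : Prop := ∃ B : ℝ, ∀ a i, |f a i| ≤ B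

lemma lin_abs_le {n : ℕ} (ξ t : Fin n → ℝ) (B : ℝ) (h : ∀ i, |t i| ≤ B) :
    |∑ i, ξ i * t i| ≤ ∑ i, |ξ i| * B := by
  refine (Finset.abs_sum_le_sum_abs _ _).trans (Finset.sum_le_sum fun i _ => ?_)
  rw [abs_mul]
  exact mul_le_mul_of_nonneg_left (h i) (abs_nonneg _)

lemma supH_bdd {n : ℕ} {A : Type*} {f : A → Fin n → ℝ} (hf : Bdd f) (ξ : Fin n → ℝ) :
    BddAbove (Set.range fun a => ∑ i, ξ i * f a i) := by
  obtain ⟨B, hB⟩ := hf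
  refine ⟨∑ i, |ξ i| * B, ?_⟩
  rintro _ ⟨a, rfl⟩
  exact (le_abs_self _).trans (lin_abs_le ξ (f a) B (hB a))

lemma le_supH {n : ℕ} {A : Type*} {f : A → Fin n → ℝ} (hf : Bdd f) (ξ : Fin n → ℝ) (a : A) :
    ∑ i, ξ i * f a i ≤ supH f ξ := le_ciSup (supH_bdd hf ξ) a

lemma supH_int {n : ℕ} {A : Type*} [Nonempty A] {f : A → Fin n → ℝ} (hf : Bdd f) :
    Integrable (supH f) (gmu n) := by
  have hm : Measurable (supH f) := by
    apply LowerSemicontinuous.measurable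
    refine lowerSemicontinuous_ciSup (supH_bdd hf) fun a => ?_
    apply Continuous.lowerSemicontinuous
    fun_prop
  have hf' := hf
  obtain ⟨B, hB⟩ := hf
  have hg : Integrable (fun ξ : Fin n → ℝ => ∑ i, |ξ i| * B) (gmu n) := by
    refine integrable_finset_sum _ fun i _ => ?_
    have h1 : Integrable (fun x : ℝ => |x| * B) (gaussianReal 0 1) := by
      have h2 : Integrable (id : ℝ → ℝ) (gaussianReal 0 1) :=
        memLp_one_iff_integrable.1 (by simpa using memLp_id_gaussianReal (μ := 0) (v := 1) 1)
      exact h2.abs.mul_const B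
    exact integrable_comp_eval (μ := fun _ : Fin n => gaussianReal 0 1) (i := i) h1
  refine hg.mono' hm.aestronglyMeasurable (Filter.Eventually.of_forall fun ξ => ?_)
  rw [Real.norm_eq_abs, abs_le]
  constructor
  · obtain ⟨a⟩ := ‹Nonempty A›
    have h1 := le_supH hf' ξ a
    have h2 := (abs_le.1 (lin_abs_le ξ (f a) B (hB a))).1
    exact h2.trans h1
  · exact ciSup_le fun a => (le_abs_self _).trans (lin_abs_le ξ (f a) B (hB a))

lemma neg_pres : MeasurePreserving (fun x : ℝ => -x) (gaussianReal 0 1) (gaussianReal 0 1) :=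
  ⟨measurable_neg, by simpa using gaussianReal_map_neg (μ := 0) (v := 1)⟩

noncomputable def flipc {n : ℕ} (I : Finset (Fin n)) (ξ : Fin n → ℝ) : Fin n → ℝ :=
  fun i => if i ∈ I then -ξ i else ξ i

lemma flip_pres {n : ℕ} (I : Finset (Fin n)) : MeasurePreserving (flipc I) (gmu n) (gmu n) := by
  have := measurePreserving_pi (fun _ : Fin n => gaussianReal 0 1)
    (fun _ : Fin n => gaussianReal 0 1)
    (f := fun i x => if i ∈ I then -x else x) (fun i => by
      by_cases h : i ∈ I
      · simpa [h] using neg_pres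
      · simp only [h, if_false]; exact MeasurePreserving.id (gaussianReal 0 1))
  exact this

lemma flip_integral {n : ℕ} (I : Finset (Fin n)) {h : (Fin n → ℝ) → ℝ}
    (hh : Integrable h (gmu n)) : Integrable (fun ξ => h (flipc I ξ)) (gmu n) ∧
    ∫ ξ, h (flipc I ξ) ∂(gmu n) = ∫ ξ, h ξ ∂(gmu n) := by
  refine ⟨(flip_pres I).integrable_comp_of_integrable hh, ?_⟩
  have h1 := (flip_pres I).map_eq
  have h2 := integral_map (f := h) (flip_pres I).measurable.aemeasurable
    (by rw [h1]; exact hh.aestronglyMeasurable)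
  rw [h1] at h2
  exact h2.symm

lemma one_step {n : ℕ} {A : Type*} [Nonempty A] {f g : A → Fin n → ℝ} (hf : Bdd f) (hg : Bdd g)
    (i0 : Fin n) (hne : ∀ a i, i ≠ i0 → f a i = g a i)
    (hc : ∀ a b, |f a i0 - f b i0| ≤ |g a i0 - g b i0|) :
    ∫ ξ, supH f ξ ∂(gmu n) ≤ ∫ ξ, supH g ξ ∂(gmu n) := by
  have key : ∀ ξ, supH f ξ + supH f (flipc {i0} ξ) ≤ supH g ξ + supH g (flipc {i0} ξ) := by
    intro ξ
    have dec : ∀ (h : A → Fin n → ℝ) a, ∑ i, ξ i * h a i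
        = ξ i0 * h a i0 + ∑ i ∈ Finset.univ.erase i0, ξ i * h a i := fun h a =>
      (Finset.add_sum_erase _ _ (Finset.mem_univ i0)).symm
    have dec' : ∀ (h : A → Fin n → ℝ) a, ∑ i, flipc {i0} ξ i * h a i
        = - ξ i0 * h a i0 + ∑ i ∈ Finset.univ.erase i0, ξ i * h a i := fun h a => by
      rw [← Finset.add_sum_erase _ _ (Finset.mem_univ i0)]
      congr 1
      · simp [flipc]
      · refine Finset.sum_congr rfl fun i hi => ?_
        have : i ≠ i0 := (Finset.mem_erase.1 hi).1
        simp [flipc, this]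
    have same : ∀ a, ∑ i ∈ Finset.univ.erase i0, ξ i * f a i
        = ∑ i ∈ Finset.univ.erase i0, ξ i * g a i := fun a =>
      Finset.sum_congr rfl fun i hi => by rw [hne a i (Finset.mem_erase.1 hi).1]
    have pw : ∀ a b, ∑ i, ξ i * f a i + ∑ i, flipc {i0} ξ i * f b i
        ≤ supH g ξ + supH g (flipc {i0} ξ) := by
      intro a b
      have ha := le_supH hg ξ a
      have hb := le_supH hg ξ b
      have ha' := le_supH hg (flipc {i0} ξ) a
      have hb' := le_supH hg (flipc {i0} ξ) b
      rw [dec] at ha hb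
      rw [dec'] at ha' hb'
      rw [dec, dec', same, same]
      have h1 : ξ i0 * (f a i0 - f b i0) ≤ |ξ i0 * (g a i0 - g b i0)| := by
        refine (le_abs_self _).trans ?_
        rw [abs_mul, abs_mul]
        exact mul_le_mul_of_nonneg_left (hc a b) (abs_nonneg _)
      rcases abs_cases (ξ i0 * (g a i0 - g b i0)) with ⟨h2, _⟩ | ⟨h2, _⟩ <;>
        rw [h2] at h1 <;> nlinarith
    have h1 : supH f (flipc {i0} ξ) ≤ supH g ξ + supH g (flipc {i0} ξ) - supH f ξ := by
      refine ciSup_le fun b => ?_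
      have : supH f ξ ≤ supH g ξ + supH g (flipc {i0} ξ) - ∑ i, flipc {i0} ξ i * f b i :=
        ciSup_le fun a => by linarith [pw a b]
      linarith
    linarith
  have hfi := supH_int hf
  have hgi := supH_int hg
  obtain ⟨f1, f2⟩ := flip_integral {i0} hfi
  obtain ⟨g1, g2⟩ := flip_integral {i0} hgi
  have := integral_mono (hfi.add f1) (hgi.add g1) key
  rw [integral_add' hfi f1, integral_add' hgi g1, f2, g2] at this
  linarith

lemma contraction {n : ℕ} {A : Type*} [Nonempty A] {f g : A → Fin n → ℝ} (hf : Bdd f) (hg : Bdd g)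
    (hc : ∀ i a b, |f a i - f b i| ≤ |g a i - g b i|) :
    ∫ ξ, supH f ξ ∂(gmu n) ≤ ∫ ξ, supH g ξ ∂(gmu n) := by
  have hyb : ∀ I : Finset (Fin n), Bdd (fun a i => if i ∈ I then f a i else g a i) := by
    intro I
    obtain ⟨B, hB⟩ := hf
    obtain ⟨C, hC⟩ := hg
    refine ⟨max B C, fun a i => ?_⟩
    dsimp only
    split_ifs
    · exact (hB a i).trans (le_max_left _ _)
    · exact (hC a i).trans (le_max_right _ _)
  have main : ∀ I : Finset (Fin n),
      ∫ ξ, supH (fun a i => if i ∈ I then f a i else g a i) ξ ∂(gmu n)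
        ≤ ∫ ξ, supH g ξ ∂(gmu n) := by
    intro I
    induction I using Finset.induction_on with
    | empty => simp
    | insert i0 I hi ih =>
      refine le_trans (one_step (hyb _) (hyb I) i0 ?_ ?_) ih
      · intro a i h
        simp [h]
      · intro a b
        simpa [hi] using hc i0 a b
  simpa using main Finset.univ

/-- Enlarged layer classes, as sets of vectors of values on the data. -/
def layerSet (φ : ℝ → ℝ) (ω : ℝ) {n D : ℕ} (X : Fin n → Fin D → ℝ) : ℕ → Set (Fin n → ℝ)
  | 0 => {t | ∃ w : Fin D → ℝ, ∑ j, |w j| ≤ ω ∧ t = fun i => ∑ j, w j * X i j}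
  | k + 1 => {t | ∃ (N : ℕ) (w : Fin N → ℝ) (s : Fin N → Fin n → ℝ), ∑ j, |w j| ≤ ω ∧
      (∀ j, s j ∈ layerSet φ ω X k) ∧ t = fun i => ∑ j, w j * φ (s j i)}

lemma wsum_le {N : ℕ} (w y : Fin N → ℝ) {ω B : ℝ} (hw : ∑ j, |w j| ≤ ω) (hB : 0 ≤ B)
    (hy : ∀ j, |y j| ≤ B) : |∑ j, w j * y j| ≤ ω * B := by
  refine (Finset.abs_sum_le_sum_abs _ _).trans ?_
  refine le_trans ?_ (mul_le_mul_of_nonneg_right hw hB)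
  rw [Finset.sum_mul]
  refine Finset.sum_le_sum fun j _ => ?_
  rw [abs_mul]
  exact mul_le_mul_of_nonneg_left (hy j) (abs_nonneg _)

lemma zero_mem_layerSet (φ : ℝ → ℝ) {ω : ℝ} (hω : 0 ≤ ω) {n D : ℕ} (X : Fin n → Fin D → ℝ)
    (k : ℕ) : (0 : Fin n → ℝ) ∈ layerSet φ ω X k := by
  cases k with
  | zero => exact ⟨0, by simpa using hω, by ext; simp⟩
  | succ k => exact ⟨0, 0, fun _ => 0, by simpa using hω, fun j => j.elim0, by ext; simp⟩

lemma layer_bdd (φ : ℝ → ℝ) {lam : ℝ} (hlam : 0 ≤ lam) (hφ1 : ∀ a, |φ a| ≤ lam * |a|)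
    {ω : ℝ} (hω : 0 ≤ ω) {n D : ℕ} (X : Fin n → Fin D → ℝ) (k : ℕ) :
    ∃ B : ℝ, 0 ≤ B ∧ ∀ t ∈ layerSet φ ω X k, ∀ i, |t i| ≤ B := by
  induction k with
  | zero =>
    have hb : ∀ i j, |X i j| ≤ ∑ i, ∑ j, |X i j| := fun i j =>
      (Finset.single_le_sum (f := fun j => |X i j|) (fun j _ => abs_nonneg _)
        (Finset.mem_univ j)).trans
      (Finset.single_le_sum (f := fun i => ∑ j, |X i j|)
        (fun i _ => Finset.sum_nonneg fun j _ => abs_nonneg _) (Finset.mem_univ i))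
    have h0 : 0 ≤ ∑ i, ∑ j, |X i j| :=
      Finset.sum_nonneg fun i _ => Finset.sum_nonneg fun j _ => abs_nonneg _
    refine ⟨ω * ∑ i, ∑ j, |X i j|, mul_nonneg hω h0, ?_⟩
    rintro t ⟨w, hw, rfl⟩ i
    exact wsum_le w _ hw h0 (hb i)
  | succ k ih =>
    obtain ⟨B, hB0, hB⟩ := ih
    have h0 : 0 ≤ lam * B := mul_nonneg hlam hB0
    refine ⟨ω * (lam * B), mul_nonneg hω h0, ?_⟩
    rintro t ⟨N, w, s, hw, hs, rfl⟩ i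
    exact wsum_le w _ hw h0 fun j =>
      (hφ1 _).trans (mul_le_mul_of_nonneg_left (hB _ (hs j) i) hlam)

lemma swap_sum {n N : ℕ} (ξ : Fin n → ℝ) (w : Fin N → ℝ) (y : Fin n → Fin N → ℝ) :
    ∑ i, ξ i * ∑ j, w j * y i j = ∑ j, w j * ∑ i, ξ i * y i j := by
  simp_rw [Finset.mul_sum]
  rw [Finset.sum_comm]
  refine Finset.sum_congr rfl fun j _ => Finset.sum_congr rfl fun i _ => by ring

noncomputable def layerH (φ : ℝ → ℝ) (ω : ℝ) {n D : ℕ} (X : Fin n → Fin D → ℝ) (k : ℕ) :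
    (Fin n → ℝ) → ℝ :=
  supH (fun t : layerSet φ ω X k => t.1)

lemma layer_step (φ : ℝ → ℝ) {lam : ℝ} (hlam : 0 ≤ lam)
    (hφ : ∀ a b : ℝ, |φ a - φ b| ≤ lam * |a - b|) (hφ0 : φ 0 = 0)
    {ω : ℝ} (hω : 0 ≤ ω) {n D : ℕ} (X : Fin n → Fin D → ℝ) (k : ℕ) :
    ∫ ξ, layerH φ ω X (k + 1) ξ ∂(gmu n) ≤ 2 * ω * lam * ∫ ξ, layerH φ ω X k ξ ∂(gmu n) := by
  have hφ1 : ∀ a, |φ a| ≤ lam * |a| := fun a => by simpa [hφ0] using hφ a 0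
  have hz := zero_mem_layerSet φ hω X
  haveI : ∀ k, Nonempty (layerSet φ ω X k) := fun k => ⟨⟨0, hz k⟩⟩
  have hbd : ∀ k, Bdd (fun t : layerSet φ ω X k => t.1) := fun k => by
    obtain ⟨B, _, hB⟩ := layer_bdd φ hlam hφ1 hω X k
    exact ⟨B, fun a i => hB _ a.2 i⟩
  obtain ⟨B, hB0, hB⟩ := layer_bdd φ hlam hφ1 hω X k
  let f : layerSet φ ω X k → Fin n → ℝ := fun t i => φ (t.1 i)
  let g : layerSet φ ω X k → Fin n → ℝ := fun t i => lam * t.1 i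
  have hf : Bdd f := ⟨lam * B, fun a i =>
    (hφ1 _).trans (mul_le_mul_of_nonneg_left (hB _ a.2 i) hlam)⟩
  have hg : Bdd g := ⟨lam * B, fun a i => by
    simp only [g, abs_mul, abs_of_nonneg hlam]
    exact mul_le_mul_of_nonneg_left (hB _ a.2 i) hlam⟩
  have hfg : ∫ ξ, supH f ξ ∂(gmu n) ≤ ∫ ξ, supH g ξ ∂(gmu n) := by
    refine contraction hf hg fun i a b => ?_
    simp only [f, g, ← mul_sub, abs_mul, abs_of_nonneg hlam]
    exact hφ _ _
  have hgl : ∀ ξ, supH g ξ = lam * layerH φ ω X k ξ := by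
    intro ξ
    unfold layerH supH
    rw [Real.mul_iSup_of_nonneg hlam]
    congr 1
    ext t
    rw [Finset.mul_sum]
    exact Finset.sum_congr rfl fun i _ => by simp only [g]; ring
  simp_rw [hgl] at hfg
  rw [integral_const_mul] at hfg
  have hfn : ∀ ξ, 0 ≤ supH f ξ := fun ξ => by
    simpa [f, hφ0] using le_supH hf ξ ⟨0, hz k⟩
  have hfi := supH_int hf
  obtain ⟨f1, f2⟩ := flip_integral Finset.univ hfi
  have pw : ∀ ξ, layerH φ ω X (k + 1) ξ ≤ ω * (supH f ξ + supH f (flipc Finset.univ ξ)) := by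
    intro ξ
    refine ciSup_le ?_
    rintro ⟨t, N, w, s, hw, hs, rfl⟩
    dsimp only
    rw [swap_sum]
    refine (le_abs_self _).trans (wsum_le w _ hw (add_nonneg (hfn _) (hfn _)) fun j => ?_)
    have h1 := le_supH hf ξ ⟨s j, hs j⟩
    have h2 := le_supH hf (flipc Finset.univ ξ) ⟨s j, hs j⟩
    simp only [flipc, Finset.mem_univ, if_true, neg_mul, Finset.sum_neg_distrib, f] at h1 h2
    have h3 := hfn ξ
    have h4 := hfn (flipc Finset.univ ξ)
    simp only [f, flipc, Finset.mem_univ, if_true] at h3 h4 ⊢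
    rw [abs_le]
    constructor <;> linarith
  have h1 := integral_mono (supH_int (hbd (k + 1))) ((hfi.add f1).const_mul ω) pw
  rw [integral_const_mul, integral_add' hfi f1, f2] at h1
  refine h1.trans ?_
  have := mul_le_mul_of_nonneg_left hfg hω
  unfold layerH at this ⊢
  linarith

lemma exp_lin {n : ℕ} (x : Fin n → ℝ) (s : ℝ) :
    Integrable (fun ξ => Real.exp (s * ∑ i, ξ i * x i)) (gmu n) ∧
    ∫ ξ, Real.exp (s * ∑ i, ξ i * x i) ∂(gmu n) = Real.exp (s ^ 2 * (∑ i, x i ^ 2) / 2) := by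
  have h0 : (fun ξ : Fin n → ℝ => Real.exp (s * ∑ i, ξ i * x i))
      = fun ξ => ∏ i, Real.exp ((s * x i) * ξ i) := by
    ext ξ
    rw [← Real.exp_sum, Finset.mul_sum]
    congr 1
    exact Finset.sum_congr rfl fun i _ => by ring
  rw [h0]
  constructor
  · exact Integrable.fintype_prod (μ := fun _ : Fin n => gaussianReal 0 1)
      (f := fun i y => Real.exp ((s * x i) * y)) fun i => integrable_exp_mul_gaussianReal _
  · unfold gmu
    rw [integral_fintype_prod_eq_prod (fun i y => Real.exp ((s * x i) * y))]
    have h1 : ∀ t : ℝ, ∫ y, Real.exp (t * y) ∂(gaussianReal 0 1) = Real.exp (t ^ 2 / 2) := by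
      intro t
      have := mgf_gaussianReal (p := gaussianReal 0 1) (X := id) (μ := 0) (v := 1) (by simp) t
      simpa [mgf] using this
    simp_rw [h1]
    rw [← Real.exp_sum]
    congr 1
    rw [Finset.mul_sum, Finset.sum_div]
    exact Finset.sum_congr rfl fun i _ => by ring

lemma base_aux (φ : ℝ → ℝ) {ω : ℝ} (hω : 0 ≤ ω) {n D : ℕ} (hD : 0 < D) (X : Fin n → Fin D → ℝ)
    {σ : ℝ} (hσ : 0 < σ) (hX : ∀ k, ∑ i, X i k ^ 2 ≤ σ ^ 2) :
    ∫ ξ, layerH φ ω X 0 ξ ∂(gmu n) ≤ ω * (Real.sqrt (2 * Real.log (2 * D)) * σ) := by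
  have hD1 : (1 : ℝ) ≤ D := by exact_mod_cast hD
  have hlog : 0 < Real.log (2 * D) := Real.log_pos (by linarith)
  set c := Real.sqrt (2 * Real.log (2 * D)) with hc
  have hc0 : 0 < c := Real.sqrt_pos.2 (by linarith)
  have hc2 : c ^ 2 = 2 * Real.log (2 * D) := Real.sq_sqrt (by linarith)
  set s := c / σ with hs
  have hs0 : 0 < s := div_pos hc0 hσ
  have hsσ : s * σ = c := div_mul_cancel₀ _ hσ.ne'
  set K := 2 * D * Real.exp (c ^ 2 / 2) with hK
  have hK0 : 0 < K := by positivity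
  have hlK : Real.log K = c ^ 2 := by
    rw [hK, Real.log_mul (by positivity) (Real.exp_pos _).ne', Real.log_exp]
    linarith
  let Y : Fin D → (Fin n → ℝ) → ℝ := fun k ξ => ∑ i, ξ i * X i k
  let Q : (Fin n → ℝ) → ℝ := fun ξ => ∑ k, (Real.exp (s * Y k ξ) + Real.exp (-s * Y k ξ))
  let R : (Fin n → ℝ) → ℝ := fun ξ => s⁻¹ * (c ^ 2 - 1 + Q ξ * K⁻¹)
  have hi : ∀ k (r : ℝ), Integrable (fun ξ => Real.exp (r * Y k ξ)) (gmu n) := fun k r =>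
    (exp_lin (fun i => X i k) r).1
  have hv : ∀ k (r : ℝ), r ^ 2 = s ^ 2 →
      ∫ ξ, Real.exp (r * Y k ξ) ∂(gmu n) ≤ Real.exp (c ^ 2 / 2) := fun k r hr => by
    have := (exp_lin (fun i => X i k) r).2
    refine this.le.trans ?_
    rw [Real.exp_le_exp, hr, ← hsσ, mul_pow]
    have := mul_le_mul_of_nonneg_left (hX k) (sq_nonneg s)
    linarith
  have hQi : Integrable Q (gmu n) :=
    integrable_finset_sum _ fun k _ => (hi k s).add (hi k (-s))
  have hQ : ∫ ξ, Q ξ ∂(gmu n) ≤ K := by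
    have : ∫ ξ, Q ξ ∂(gmu n) = ∑ k, ∫ ξ, (Real.exp (s * Y k ξ) + Real.exp (-s * Y k ξ)) ∂(gmu n) :=
      integral_finset_sum _ fun k _ => (hi k s).add (hi k (-s))
    rw [this]
    have h2 : ∀ k ∈ (Finset.univ : Finset (Fin D)),
        ∫ ξ, (Real.exp (s * Y k ξ) + Real.exp (-s * Y k ξ)) ∂(gmu n)
          ≤ 2 * Real.exp (c ^ 2 / 2) := fun k _ => by
      rw [integral_add (hi k s) (hi k (-s))]
      linarith [hv k s rfl, hv k (-s) (by ring)]
    refine (Finset.sum_le_sum h2).trans ?_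
    simp only [Finset.sum_const, Finset.card_univ, Fintype.card_fin, nsmul_eq_mul, hK]
    linarith
  have hRi : Integrable R (gmu n) :=
    ((integrable_const (c ^ 2 - 1)).add (hQi.mul_const K⁻¹)).const_mul s⁻¹
  have hR : ∫ ξ, R ξ ∂(gmu n) ≤ c * σ := by
    simp only [R]
    rw [integral_const_mul, integral_add (integrable_const _) (hQi.mul_const K⁻¹),
      integral_mul_const, integral_const]
    simp only [probReal_univ, smul_eq_mul, one_mul]
    have h1 : (∫ ξ, Q ξ ∂(gmu n)) * K⁻¹ ≤ 1 := by
      rw [← div_eq_mul_inv, div_le_one hK0]; exact hQ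
    have h2 : s⁻¹ * (c ^ 2 - 1 + (∫ ξ, Q ξ ∂(gmu n)) * K⁻¹) ≤ s⁻¹ * c ^ 2 :=
      mul_le_mul_of_nonneg_left (by linarith) (inv_pos.2 hs0).le
    refine h2.trans (le_of_eq ?_)
    rw [hs]; field_simp
  have hlogle : ∀ y : ℝ, ∀ ξ, Real.exp (s * y) ≤ Q ξ → y ≤ R ξ := by
    intro y ξ h
    have h1 : s * y ≤ c ^ 2 - 1 + Q ξ * K⁻¹ := by
      have h2 := Real.log_le_sub_one_of_pos (x := Real.exp (s * y) * K⁻¹) (by positivity)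
      rw [Real.log_mul (Real.exp_pos _).ne' (by positivity), Real.log_exp, Real.log_inv, hlK] at h2
      have h3 := mul_le_mul_of_nonneg_right h (inv_pos.2 hK0).le
      linarith
    simp only [R]
    rw [inv_mul_eq_div, le_div_iff₀ hs0]
    linarith
  have hYR : ∀ k ξ, |Y k ξ| ≤ R ξ := by
    intro k ξ
    have h1 : Real.exp (s * Y k ξ) + Real.exp (-s * Y k ξ) ≤ Q ξ :=
      Finset.single_le_sum (f := fun k => Real.exp (s * Y k ξ) + Real.exp (-s * Y k ξ))
        (fun k _ => by positivity) (Finset.mem_univ k)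
    have e1 := Real.exp_pos (s * Y k ξ)
    have e2 := Real.exp_pos (-s * Y k ξ)
    rw [abs_le']
    exact ⟨hlogle _ _ (by linarith), hlogle _ _ (by
      rw [mul_neg, ← neg_mul]; linarith)⟩
  have hR0 : ∀ ξ, 0 ≤ R ξ := fun ξ => (abs_nonneg _).trans (hYR ⟨0, hD⟩ ξ)
  have pw : ∀ ξ, layerH φ ω X 0 ξ ≤ ω * R ξ := by
    intro ξ
    refine Real.iSup_le ?_ (mul_nonneg hω (hR0 ξ))
    rintro ⟨t, w, hw, rfl⟩
    dsimp only
    rw [swap_sum]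
    exact (le_abs_self _).trans (wsum_le w _ hw (hR0 ξ) fun k => hYR k ξ)
  have hnn : ∀ ξ, 0 ≤ layerH φ ω X 0 ξ := fun ξ =>
    Real.iSup_nonneg' ⟨⟨0, zero_mem_layerSet φ hω X 0⟩, by simp⟩
  refine (integral_mono_of_nonneg (Filter.Eventually.of_forall hnn) (hRi.const_mul ω)
    (Filter.Eventually.of_forall pw)).trans ?_
  rw [integral_const_mul]
  exact mul_le_mul_of_nonneg_left hR hω

lemma base (φ : ℝ → ℝ) {ω : ℝ} (hω : 0 ≤ ω) {n D : ℕ} (hD : 0 < D) (X : Fin n → Fin D → ℝ) :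
    ∫ ξ, layerH φ ω X 0 ξ ∂(gmu n) ≤ ω * (Real.sqrt (2 * Real.log (2 * D)) *
      ⨆ k : Fin D, Real.sqrt (∑ i, X i k ^ 2)) := by
  set σ := ⨆ k : Fin D, Real.sqrt (∑ i, X i k ^ 2) with hσ
  have hσ0 : 0 ≤ σ := Real.iSup_nonneg fun k => Real.sqrt_nonneg _
  have hk : ∀ k, Real.sqrt (∑ i, X i k ^ 2) ≤ σ := fun k =>
    le_ciSup (f := fun k => Real.sqrt (∑ i, X i k ^ 2)) (Set.finite_range _).bddAbove k
  have h1 : ∀ τ > σ, ∫ ξ, layerH φ ω X 0 ξ ∂(gmu n)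
      ≤ ω * (Real.sqrt (2 * Real.log (2 * D)) * τ) := fun τ hτ =>
    base_aux φ hω hD X (hσ0.trans_lt hτ) fun k => (Real.sqrt_le_iff.1 ((hk k).trans hτ.le)).2
  have hcont : Filter.Tendsto (fun τ => ω * (Real.sqrt (2 * Real.log (2 * D)) * τ))
      (nhdsWithin σ (Set.Ioi σ)) (nhds (ω * (Real.sqrt (2 * Real.log (2 * D)) * σ))) :=
    Filter.Tendsto.mono_left (Continuous.tendsto (by fun_prop) σ) nhdsWithin_le_nhds
  refine ge_of_tendsto hcont ?_
  filter_upwards [self_mem_nhdsWithin] with τ hτ using h1 τ hτ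

lemma row_le {a b : ℕ} (W : Matrix (Fin a) (Fin b) ℝ) {ω : ℝ} (h : norm1inf W ≤ ω) (r : Fin a) :
    ∑ j, |W r j| ≤ ω :=
  (le_ciSup (f := fun i => ∑ j, |W i j|) (Set.finite_range _).bddAbove r).trans h

lemma net_mem (φ : ℝ → ℝ) (d : ℕ → ℕ) (ω : ℝ) {n : ℕ} (X : Fin n → Fin (d 0) → ℝ)
    (W : ∀ k : ℕ, Matrix (Fin (d (k + 1))) (Fin (d k)) ℝ) (k : ℕ)
    (hW : ∀ j, j ≤ k → norm1inf (W j) ≤ ω) (r : Fin (d (k + 1))) :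
    (fun i => (W k).mulVec (nnHidden φ d W (X i) k) r) ∈ layerSet φ ω X k := by
  induction k with
  | zero => exact ⟨W 0 r, row_le _ (hW 0 le_rfl) r, rfl⟩
  | succ k ih =>
    exact ⟨d (k + 1), W (k + 1) r,
      fun j i => (W k).mulVec (nnHidden φ d W (X i) k) j, row_le _ (hW _ le_rfl) r,
      fun j => ih (fun l hl => hW l (by omega)) j, rfl⟩

/-- Gaussian complexity bound for feed-forward networks: for data `X ∈ ℝ^{n×d₀}`,
`G(F(X)) ≤ (2ω)^ι λ^{ι−1} √(2 log(2d₀)) · max_k √(Σ_i X_{i,k}²)` with `ι = m+1`. -/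
theorem stmt_18 (φ : ℝ → ℝ) (lam : ℝ) (hlam : 0 ≤ lam)
    (hφ : ∀ a b : ℝ, |φ a - φ b| ≤ lam * |a - b|) (hφ0 : φ 0 = 0)
    (d : ℕ → ℕ) (m : ℕ) (hlast : d (m + 1) = 1) (hd0 : 0 < d 0)
    (ω : ℝ) (hω : 0 ≤ ω)
    (n : ℕ) (X : Fin n → Fin (d 0) → ℝ) :
    (∫ ξ, (⨆ g : nnClass φ d m ω, ∑ i, ξ i * g.1 (X i))
        ∂(Measure.pi fun _ : Fin n => gaussianReal 0 1))
      ≤ (2 * ω) ^ (m + 1) * lam ^ m * Real.sqrt (2 * Real.log (2 * d 0)) *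
        ⨆ k : Fin (d 0), Real.sqrt (∑ i, X i k ^ 2) := by
  have hφ1 : ∀ a, |φ a| ≤ lam * |a| := fun a => by simpa [hφ0] using hφ a 0
  have hstep : ∀ k, ∫ ξ, layerH φ ω X k ξ ∂(gmu n) ≤ (2 * ω * lam) ^ k *
      (ω * (Real.sqrt (2 * Real.log (2 * d 0)) * ⨆ k : Fin (d 0), Real.sqrt (∑ i, X i k ^ 2))) := by
    intro k
    induction k with
    | zero => simpa using base φ hω hd0 X
    | succ k ih =>
      refine (layer_step φ hlam hφ hφ0 hω X k).trans ?_
      rw [pow_succ', mul_assoc (2 * ω * lam)]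
      exact mul_le_mul_of_nonneg_left ih (by positivity)
  have hbd : Bdd (fun t : layerSet φ ω X m => t.1) := by
    obtain ⟨B, _, hB⟩ := layer_bdd φ hlam hφ1 hω X m
    exact ⟨B, fun a i => hB _ a.2 i⟩
  haveI : Nonempty (layerSet φ ω X m) := ⟨⟨0, zero_mem_layerSet φ hω X m⟩⟩
  have hH0 : ∀ ξ, 0 ≤ layerH φ ω X m ξ := fun ξ =>
    Real.iSup_nonneg' ⟨⟨0, zero_mem_layerSet φ hω X m⟩, by simp⟩
  have h1 : (∫ ξ, (⨆ g : nnClass φ d m ω, ∑ i, ξ i * g.1 (X i)) ∂(gmu n))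
      ≤ ∫ ξ, layerH φ ω X m ξ ∂(gmu n) := by
    refine integral_mono_of_nonneg (Filter.Eventually.of_forall fun ξ => ?_) (supH_int hbd)
      (Filter.Eventually.of_forall fun ξ => ?_)
    · refine Real.iSup_nonneg' ⟨⟨fun _ => 0, fun _ => 0, fun k _ => ?_, ?_⟩, by simp⟩
      · exact Real.iSup_le (fun i => by simpa using hω) hω
      · ext x
        simp
    · refine Real.iSup_le ?_ (hH0 ξ)
      rintro ⟨g, W, hW, rfl⟩
      have hr : ∀ v : Fin (d (m + 1)) → ℝ, ∑ i, v i = v ⟨0, by omega⟩ := by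
        intro v
        refine Finset.sum_eq_single _ (fun b _ hb => ?_) (by simp)
        exact absurd (Fin.ext (by have := b.2; simp; omega)) hb
      simp only [hr]
      exact le_supH hbd ξ ⟨_, net_mem φ d ω X W m hW ⟨0, by omega⟩⟩
  refine (h1.trans (hstep m)).trans ?_
  have hσ0 : 0 ≤ ⨆ k : Fin (d 0), Real.sqrt (∑ i, X i k ^ 2) :=
    Real.iSup_nonneg fun k => Real.sqrt_nonneg _
  have hP : 0 ≤ (2 * ω * lam) ^ m *
      (ω * (Real.sqrt (2 * Real.log (2 * d 0)) * ⨆ k : Fin (d 0), Real.sqrt (∑ i, X i k ^ 2))) := by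
    positivity
  calc _ ≤ 2 * ((2 * ω * lam) ^ m *
      (ω * (Real.sqrt (2 * Real.log (2 * d 0)) *
        ⨆ k : Fin (d 0), Real.sqrt (∑ i, X i k ^ 2)))) := by linarith
    _ = _ := by rw [mul_pow (2 * ω) lam, pow_succ]; ring
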